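/- Let l ∈ (−1, 0), γ > 0, k₁ > 0, k₂ > 0, and set b = 1/(1−l) and a = (1+l)/(1−l), so that a ∈ (0,1) and b ∈ (1/2,1). Let y, x : ℝ → ℝ be continuously differentiable functions satisfying, for all t ≥ 0, y'(t) = γ·(−k₁·⌈y(t)⌋^{b} + x(t)) and x'(t) = −k₂·⌈y(t)⌋^{a}, where ⌈s⌋^{p} := |s|^{p}·sign(s). Then there exists T ≥ 0 such that y(t) = 0 and x(t) = 0 for all t ≥ T. -/

import Mathlib

/-- The signed power `⌈s⌋^p = |s|^p · sign(s)` (applied element-wise in the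
paper's controller). -/
noncomputable def signedPow (p s : ℝ) : ℝ := |s| ^ p * Real.sign s

/-- A positive quantity cannot satisfy `V' ≤ -c V^q` with `c > 0` and `q < 1` for all times. -/
theorem false_of_deriv_le_neg_rpow {V V' : ℝ → ℝ} {c q : ℝ} (hc : 0 < c) (hq : q < 1)
    (hpos : ∀ t ≥ (0 : ℝ), 0 < V t) (hV : ∀ t ≥ (0 : ℝ), HasDerivAt V (V' t) t)
    (hle : ∀ t ≥ (0 : ℝ), V' t ≤ -c * V t ^ q) : False := by
  have hd : ∀ t ≥ (0 : ℝ), HasDerivAt (fun s => V s ^ (1 - q) + (1 - q) * c * s)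
      (V' t * (1 - q) * V t ^ (1 - q - 1) + (1 - q) * c * 1) t := fun t ht =>
    ((hV t ht).rpow_const (Or.inl (hpos t ht).ne')).add ((hasDerivAt_id t).const_mul _)
  have hanti : AntitoneOn (fun s => V s ^ (1 - q) + (1 - q) * c * s) (Set.Ici 0) := by
    refine antitoneOn_of_hasDerivWithinAt_nonpos (convex_Ici 0)
      (fun t ht => (hd t ht).continuousAt.continuousWithinAt)
      (fun t ht => (hd t (interior_subset ht)).hasDerivWithinAt) (fun t ht => ?_)
    have ht0 : t ≥ 0 := interior_subset ht
    have hinv : V t ^ q * V t ^ (1 - q - 1) = 1 := by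
      rw [← Real.rpow_add (hpos t ht0)]; simp
    have h := mul_le_mul_of_nonneg_right (hle t ht0)
      (mul_nonneg (sub_pos.2 hq).le (Real.rpow_nonneg (hpos t ht0).le (1 - q - 1)))
    linear_combination h + (-(1 - q) * c) * hinv
  have hk : 0 < (1 - q) * c := mul_pos (sub_pos.2 hq) hc
  set t := V 0 ^ (1 - q) / ((1 - q) * c) with ht
  have h0 : 0 ≤ t := div_nonneg (Real.rpow_nonneg (hpos 0 le_rfl).le _) hk.le
  have h := hanti Set.self_mem_Ici h0 h0
  have ht' : (1 - q) * c * t = V 0 ^ (1 - q) := by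
    rw [ht, mul_div_cancel₀ _ hk.ne']
  have := Real.rpow_pos_of_pos (hpos t h0) (1 - q)
  simp only [ht', mul_zero, add_zero] at h
  linarith

theorem abs_mul_realSign (s : ℝ) : |s| * Real.sign s = s := by
  rcases lt_trichotomy s 0 with h | rfl | h
  · rw [Real.sign_of_neg h, abs_of_neg h]; ring
  · simp
  · rw [Real.sign_of_pos h, abs_of_pos h]; ring

theorem mul_realSign (s : ℝ) : s * Real.sign s = |s| := by
  rcases lt_trichotomy s 0 with h | rfl | h
  · rw [Real.sign_of_neg h, abs_of_neg h]; ring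
  · simp
  · rw [Real.sign_of_pos h, abs_of_pos h]; ring

theorem signedPow_mul_signedPow {p q : ℝ} (hpq : p + q ≠ 0) (s : ℝ) :
    signedPow p s * signedPow q s = |s| ^ (p + q) := by
  unfold signedPow
  rcases lt_trichotomy s 0 with h | rfl | h
  · rw [Real.sign_of_neg h, Real.rpow_add (abs_pos.2 h.ne)]; ring
  · simp [Real.zero_rpow hpq]
  · rw [Real.sign_of_pos h, Real.rpow_add (abs_pos.2 h.ne')]; ring

theorem mul_signedPow {p : ℝ} (hp : p + 1 ≠ 0) (s : ℝ) :
    s * signedPow p s = |s| ^ (p + 1) := by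
  unfold signedPow
  rcases eq_or_ne s 0 with rfl | h
  · simp [Real.zero_rpow hp]
  · rw [Real.rpow_add_one (abs_pos.2 h).ne']
    linear_combination |s| ^ p * mul_realSign s

theorem abs_signedPow_le (p s : ℝ) : |signedPow p s| ≤ |s| ^ p := by
  unfold signedPow
  rw [abs_mul, abs_of_nonneg (Real.rpow_nonneg (abs_nonneg s) p)]
  refine mul_le_of_le_one_right (Real.rpow_nonneg (abs_nonneg s) p) ?_
  rcases Real.sign_apply_eq s with h | h | h <;> simp [h]

theorem hasDerivAt_abs_rpow_signedPow {p : ℝ} (hp : 1 < p) (s : ℝ) :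
    HasDerivAt (fun s : ℝ => |s| ^ p) (p * signedPow (p - 1) s) s := by
  convert hasDerivAt_abs_rpow s hp using 1
  unfold signedPow
  rcases eq_or_ne s 0 with rfl | h
  · simp
  · have h1 : |s| ^ (p - 1) = |s| ^ (p - 2) * |s| := by
      rw [← Real.rpow_add_one (abs_pos.2 h).ne']; ring_nf
    rw [h1]
    linear_combination p * |s| ^ (p - 2) * abs_mul_realSign s

/-- Mechanical energy of the closed loop. -/
noncomputable def loopEnergy (γ k₂ b y x : ℝ) : ℝ := k₂ / (2 * b) * |y| ^ (2 * b) + γ / 2 * x ^ 2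

section Energy

variable {γ k₁ k₂ b : ℝ}

theorem loopEnergy_nonneg (hγ : 0 < γ) (hk₂ : 0 < k₂) (hb : 0 < b) (y x : ℝ) :
    0 ≤ loopEnergy γ k₂ b y x := by
  unfold loopEnergy; positivity

theorem eq_zero_of_loopEnergy_eq_zero (hγ : 0 < γ) (hk₂ : 0 < k₂) (hb : 0 < b) {y x : ℝ}
    (h : loopEnergy γ k₂ b y x = 0) : y = 0 ∧ x = 0 := by
  unfold loopEnergy at h
  have hc : 0 < k₂ / (2 * b) := by positivity
  have h1 : 0 ≤ k₂ / (2 * b) * |y| ^ (2 * b) := by positivity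
  have h2 : 0 ≤ γ / 2 * x ^ 2 := by positivity
  constructor
  · by_contra hy
    have : 0 < |y| := abs_pos.2 hy
    have : 0 < k₂ / (2 * b) * |y| ^ (2 * b) := by positivity
    linarith
  · by_contra hx
    have : 0 < γ / 2 * x ^ 2 := by positivity
    linarith

theorem abs_mul_le_loopEnergy_rpow (hγ : 0 < γ) (hk₂ : 0 < k₂) (hb : 0 < b) (y x : ℝ) :
    |y * x| ≤ (2 * b / k₂) ^ (1 / (2 * b)) * (2 / γ) ^ (1 / 2 : ℝ) *
      loopEnergy γ k₂ b y x ^ (1 / (2 * b) + 1 / 2) := by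
  have hE := loopEnergy_nonneg hγ hk₂ hb y x
  have hy : |y| ≤ (2 * b / k₂ * loopEnergy γ k₂ b y x) ^ (1 / (2 * b)) := by
    have h : |y| ^ (2 * b) ≤ 2 * b / k₂ * loopEnergy γ k₂ b y x := by
      have h2 : 0 ≤ 2 * b / k₂ * (γ / 2 * x ^ 2) := by positivity
      have h3 : 2 * b / k₂ * (k₂ / (2 * b) * |y| ^ (2 * b)) = |y| ^ (2 * b) := by field_simp
      unfold loopEnergy
      linarith
    calc |y| = (|y| ^ (2 * b)) ^ (1 / (2 * b)) := by
          rw [one_div, Real.rpow_rpow_inv (abs_nonneg y) (by positivity)]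
      _ ≤ _ := Real.rpow_le_rpow (by positivity) h (by positivity)
  have hx : |x| ≤ (2 / γ * loopEnergy γ k₂ b y x) ^ (1 / 2 : ℝ) := by
    rw [← Real.sqrt_eq_rpow]
    refine Real.abs_le_sqrt ?_
    have h2 : 0 ≤ 2 / γ * (k₂ / (2 * b) * |y| ^ (2 * b)) := by positivity
    have h3 : 2 / γ * (γ / 2 * x ^ 2) = x ^ 2 := by field_simp
    unfold loopEnergy
    linarith
  rw [abs_mul]
  refine (mul_le_mul hy hx (abs_nonneg x) (by positivity)).trans_eq ?_
  rw [Real.mul_rpow (by positivity) hE, Real.mul_rpow (by positivity) hE,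
    Real.rpow_add_of_nonneg hE (by positivity) (by positivity)]
  ring

theorem le_loopEnergy_rpow_mul (hγ : 0 < γ) (hk₂ : 0 < k₂) (hb : 1 / 2 < b) (hb1 : b < 1)
    (y x : ℝ) :
    (k₂ / (2 * b)) ^ (1 / (2 * b) - 1 / 2) * |y| ^ (2 * b) ≤
      loopEnergy γ k₂ b y x ^ (1 / (2 * b) - 1 / 2) * |y| ^ (3 * b - 1) := by
  have hb0 : 0 < b := by linarith
  have he : 0 ≤ 1 / (2 * b) - 1 / 2 := by
    rw [sub_nonneg]; exact one_div_le_one_div_of_le (by linarith) (by linarith)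
  have hs : |y| ^ (2 * b) = (|y| ^ (2 * b)) ^ (1 / (2 * b) - 1 / 2) * |y| ^ (3 * b - 1) := by
    rw [← Real.rpow_mul (abs_nonneg y),
      ← Real.rpow_add_of_nonneg (abs_nonneg y) (by positivity) (by linarith)]
    congr 1; field_simp; ring
  calc _ = (k₂ / (2 * b) * |y| ^ (2 * b)) ^ (1 / (2 * b) - 1 / 2) * |y| ^ (3 * b - 1) := by
        rw [Real.mul_rpow (by positivity) (by positivity), mul_assoc, ← hs]
    _ ≤ _ := by
        refine mul_le_mul_of_nonneg_right (Real.rpow_le_rpow (by positivity) ?_ he) (by positivity)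
        have : 0 ≤ γ / 2 * x ^ 2 := by positivity
        unfold loopEnergy
        linarith

theorem hasDerivAt_loopEnergy (hb : 1 / 2 < b) {y x : ℝ → ℝ} {t : ℝ}
    (hy : HasDerivAt y (γ * (-k₁ * signedPow b (y t) + x t)) t)
    (hx : HasDerivAt x (-k₂ * signedPow (2 * b - 1) (y t)) t) :
    HasDerivAt (fun s => loopEnergy γ k₂ b (y s) (x s))
      (-(γ * k₁ * k₂) * |y t| ^ (3 * b - 1)) t := by
  unfold loopEnergy
  have h1 := (((hasDerivAt_abs_rpow_signedPow (p := 2 * b) (by linarith) (y t)).comp t hy).const_mul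
    (k₂ / (2 * b))).add ((hx.pow 2).const_mul (γ / 2))
  refine h1.congr_deriv ?_
  have h2 := signedPow_mul_signedPow (p := 2 * b - 1) (q := b) (by linarith) (y t)
  rw [show 2 * b - 1 + b = 3 * b - 1 by ring] at h2
  rw [← h2]
  have : b ≠ 0 := by linarith
  field_simp
  push_cast
  ring

end Energy

/-- The cross-term correction of the energy dissipates at a definite rate. -/
theorem quadratic_dissipation {C D ε γ k₁ k₂ u w x : ℝ} (hγ : 0 ≤ γ) (hε : 0 ≤ ε)
    (hεC : ε * (k₂ + γ * k₁ ^ 2 / 2) ≤ C / 2) (hw : |w| ≤ u) (hD : C * u ^ 2 ≤ D) :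
    -D - ε * (γ * (-k₁ * w + x) * x - k₂ * u ^ 2) ≤ -(C / 2 * u ^ 2 + ε * γ / 2 * x ^ 2) := by
  have h1 : w ^ 2 ≤ u ^ 2 := sq_le_sq.2 (hw.trans (le_abs_self u))
  have h2 := mul_le_mul_of_nonneg_right hεC (sq_nonneg u)
  have h3 := mul_nonneg (mul_nonneg hε hγ) (sq_nonneg (k₁ * w - x))
  have h4 := mul_le_mul_of_nonneg_left h1 (mul_nonneg (mul_nonneg hε hγ) (sq_nonneg k₁))
  linarith

/-- The energy of a closed-loop trajectory vanishes at some time. -/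
theorem exists_loopEnergy_eq_zero {γ k₁ k₂ b : ℝ} (hγ : 0 < γ) (hk₁ : 0 < k₁) (hk₂ : 0 < k₂)
    (hb : 1 / 2 < b) (hb1 : b < 1) {y x : ℝ → ℝ}
    (hy : ∀ t ≥ (0 : ℝ), HasDerivAt y (γ * (-k₁ * signedPow b (y t) + x t)) t)
    (hx : ∀ t ≥ (0 : ℝ), HasDerivAt x (-k₂ * signedPow (2 * b - 1) (y t)) t) :
    ∃ T ≥ (0 : ℝ), loopEnergy γ k₂ b (y T) (x T) = 0 := by
  by_contra! hne
  have hb0 : 0 < b := by linarith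
  set E : ℝ → ℝ := fun s => loopEnergy γ k₂ b (y s) (x s) with hEdef
  have hEpos : ∀ t ≥ (0 : ℝ), 0 < E t := fun t ht =>
    lt_of_le_of_ne (loopEnergy_nonneg hγ hk₂ hb0 _ _) (hne t ht).symm
  set p := 1 / (2 * b) + 1 / 2 with hp
  have hp1 : 1 < p := by
    have : 1 / 2 < 1 / (2 * b) := one_div_lt_one_div_of_lt (by linarith) (by linarith)
    linarith
  have hp0 : 0 < p := by linarith
  obtain ⟨B, hB, hBle⟩ : ∃ B > 0, ∀ t, |y t * x t| ≤ B * E t ^ p :=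
    ⟨_, by positivity, fun t => abs_mul_le_loopEnergy_rpow hγ hk₂ hb0 (y t) (x t)⟩
  obtain ⟨A, hA, hAle⟩ : ∃ A > 0, ∀ t,
      A * |y t| ^ (2 * b) ≤ E t ^ (p - 1) * |y t| ^ (3 * b - 1) := by
    refine ⟨(k₂ / (2 * b)) ^ (1 / (2 * b) - 1 / 2), by positivity, fun t => ?_⟩
    rw [show p - 1 = 1 / (2 * b) - 1 / 2 by rw [hp]; ring]
    exact le_loopEnergy_rpow_mul hγ hk₂ hb hb1 (y t) (x t)
  set C := p * (γ * k₁ * k₂) * A with hC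
  have hC0 : 0 < C := by positivity
  obtain ⟨ε, hε, hεC, hεB⟩ : ∃ ε > 0, ε * (k₂ + γ * k₁ ^ 2 / 2) ≤ C / 2 ∧ ε * B ≤ 1 / 2 := by
    refine ⟨min (C / 2 / (k₂ + γ * k₁ ^ 2 / 2)) (1 / 2 / B), by positivity, ?_, ?_⟩
    · rw [← le_div_iff₀ (by positivity)]; exact min_le_left _ _
    · rw [← le_div_iff₀ hB]; exact min_le_right _ _
  obtain ⟨m, hm, hmC, hmε⟩ : ∃ m > 0, m * (k₂ / (2 * b)) ≤ C / 2 ∧ m ≤ ε := by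
    refine ⟨min (C / 2 / (k₂ / (2 * b))) ε, by positivity, ?_, min_le_right _ _⟩
    rw [← le_div_iff₀ (by positivity)]; exact min_le_left _ _
  have hcross : ∀ t ≥ (0 : ℝ), |ε * (y t * x t)| ≤ 1 / 2 * E t ^ p := fun t ht => by
    rw [abs_mul, abs_of_pos hε]
    calc ε * |y t * x t| ≤ ε * (B * E t ^ p) := mul_le_mul_of_nonneg_left (hBle t) hε.le
      _ = ε * B * E t ^ p := by ring
      _ ≤ _ := mul_le_mul_of_nonneg_right hεB (Real.rpow_nonneg (hEpos t ht).le _)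
  have hVpos : ∀ t ≥ (0 : ℝ), 0 < E t ^ p - ε * (y t * x t) := fun t ht => by
    have := Real.rpow_pos_of_pos (hEpos t ht) p
    linarith [(abs_le.1 (hcross t ht)).2]
  refine false_of_deriv_le_neg_rpow (c := m * (2 / 3) ^ (1 / p)) (q := 1 / p) (by positivity)
    ((div_lt_one hp0).2 hp1) hVpos (fun t ht => (((hasDerivAt_loopEnergy hb (hy t ht)
      (hx t ht)).rpow_const (p := p) (Or.inl (hEpos t ht).ne')).sub
      (((hy t ht).mul (hx t ht)).const_mul ε))) (fun t ht => ?_)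
  have hu : |y t| ^ (2 * b) = (|y t| ^ b) ^ 2 := by
    rw [← Real.rpow_mul_natCast (abs_nonneg _)]; norm_num [mul_comm]
  have hyy := mul_signedPow (p := 2 * b - 1) (by linarith) (y t)
  rw [sub_add_cancel, hu] at hyy
  have hdiss := quadratic_dissipation (D := p * (γ * k₁ * k₂) * (E t ^ (p - 1) *
      |y t| ^ (3 * b - 1))) (x := x t) hγ.le hε.le hεC (abs_signedPow_le b (y t)) (by
    rw [hC, mul_assoc, ← hu]
    exact mul_le_mul_of_nonneg_left (hAle t) (by positivity))
  have hmE : m * E t ≤ C / 2 * (|y t| ^ b) ^ 2 + ε * γ / 2 * x t ^ 2 := by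
    have h1 := mul_le_mul_of_nonneg_right hmC (sq_nonneg (|y t| ^ b))
    have h2 := mul_le_mul_of_nonneg_right hmε (show 0 ≤ γ / 2 * x t ^ 2 by positivity)
    simp only [hEdef, loopEnergy, hu]
    linarith
  have hVE : (2 / 3 : ℝ) ^ (1 / p) * (E t ^ p - ε * (y t * x t)) ^ (1 / p) ≤ E t := by
    rw [← Real.mul_rpow (by norm_num) (hVpos t ht).le]
    calc _ ≤ (E t ^ p) ^ (1 / p) := by
          refine Real.rpow_le_rpow (mul_nonneg (by norm_num) (hVpos t ht).le) ?_ (by positivity)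
          linarith [(abs_le.1 (hcross t ht)).1]
      _ = E t := by rw [one_div, Real.rpow_rpow_inv (hEpos t ht).le hp0.ne']
  have hmV := mul_le_mul_of_nonneg_left hVE hm.le
  change -(γ * k₁ * k₂) * |y t| ^ (3 * b - 1) * p * E t ^ (p - 1) - _ ≤ _
  linear_combination hdiss + hmE + hmV + ε * k₂ * hyy

/-- Finite-time stability of the homogeneous closed loop for `l ∈ (−1, 0)`
(unperturbed case, scalar pair after diagonal decoupling): every solution of
`ẏ = γ(−k₁⌈y⌋^b + x)`, `ẋ = −k₂⌈y⌋^a` with `b = 1/(1−l)`,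
`a = (1+l)/(1−l)` reaches the origin in finite time and stays there. -/
theorem closed_loop_finite_time_stable
    (l γ k₁ k₂ b a : ℝ) (hl : l ∈ Set.Ioo (-1 : ℝ) 0)
    (hγ : 0 < γ) (hk₁ : 0 < k₁) (hk₂ : 0 < k₂)
    (hb : b = 1 / (1 - l)) (ha : a = (1 + l) / (1 - l))
    (y x : ℝ → ℝ) (hy : ContDiff ℝ 1 y) (hx : ContDiff ℝ 1 x)
    (hyd : ∀ t ≥ (0:ℝ), HasDerivAt y (γ * (-k₁ * signedPow b (y t) + x t)) t)
    (hxd : ∀ t ≥ (0:ℝ), HasDerivAt x (-k₂ * signedPow a (y t)) t) :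
    ∃ T ≥ (0:ℝ), ∀ t ≥ T, y t = 0 ∧ x t = 0 := by
  have h1l : 0 < 1 - l := by linarith [hl.2]
  have hab : a = 2 * b - 1 := by rw [ha, hb]; field_simp; ring
  have hb2 : 1 / 2 < b := by
    rw [hb]; exact one_div_lt_one_div_of_lt h1l (by linarith [hl.1])
  have hb1 : b < 1 := by rw [hb, div_lt_one h1l]; linarith [hl.2]
  have hb0 : 0 < b := by linarith
  subst hab
  obtain ⟨T, hT, hET⟩ := exists_loopEnergy_eq_zero hγ hk₁ hk₂ hb2 hb1 hyd hxd
  have hd := fun t (ht : t ≥ 0) => hasDerivAt_loopEnergy hb2 (hyd t ht) (hxd t ht)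
  have hanti : AntitoneOn (fun s => loopEnergy γ k₂ b (y s) (x s)) (Set.Ici 0) := by
    refine antitoneOn_of_hasDerivWithinAt_nonpos (convex_Ici 0)
      (fun t ht => (hd t ht).continuousAt.continuousWithinAt)
      (fun t ht => (hd t (interior_subset ht)).hasDerivWithinAt) (fun t _ => ?_)
    rw [neg_mul, neg_nonpos]
    positivity
  refine ⟨T, hT, fun t ht => eq_zero_of_loopEnergy_eq_zero hγ hk₂ hb0 ?_⟩
  exact le_antisymm ((hanti hT (hT.trans ht) ht).trans_eq hET)
    (loopEnergy_nonneg hγ hk₂ hb0 _ _)
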